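/- arXiv:1808.10217 — 9 statements merged into one kernel-verified Lean document; each statement's English description precedes it below -/
import Mathlib

section
/- The SINR map Λ is injective on the nonnegative orthant: if β, β' ∈ ℝ^N satisfy β_i ≥ 0 and β'_i ≥ 0 for all i ∈ N, and Λ_i(β) = Λ_i(β') for every i ∈ N, then β = β'. -/
/-- The SINR map `Λ_i (β) = β_i / (∑_{j ≠ i} β_j + σ²)` is injective on the
nonnegative orthant. -/
theorem sinr_map_injective_on_nonneg
    {N : Type*} [Fintype N] [DecidableEq N]
    (σ2 : ℝ) (hσ2 : 0 < σ2)
    (β β' : N → ℝ) (hβ : ∀ i, 0 ≤ β i) (hβ' : ∀ i, 0 ≤ β' i)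
    (h : ∀ i, β i / ((∑ j ∈ Finset.univ.erase i, β j) + σ2)
            = β' i / ((∑ j ∈ Finset.univ.erase i, β' j) + σ2)) :
    β = β' := by
  have pos : ∀ γ : N → ℝ, (∀ i, 0 ≤ γ i) → ∀ i, 0 < (∑ j ∈ Finset.univ.erase i, γ j) + σ2 :=
    fun γ hγ i => add_pos_of_nonneg_of_pos (Finset.sum_nonneg fun j _ => hγ j) hσ2
  have key : ∀ i, β i * ((∑ j, β' j) + σ2) = β' i * ((∑ j, β j) + σ2) := by
    intro i
    have hi := h i
    rw [div_eq_div_iff (pos β hβ i).ne' (pos β' hβ' i).ne'] at hi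
    rw [← Finset.add_sum_erase Finset.univ β (Finset.mem_univ i),
      ← Finset.add_sum_erase Finset.univ β' (Finset.mem_univ i)]
    linarith
  have hs : (∑ j, β j) * ((∑ j, β' j) + σ2) = (∑ j, β' j) * ((∑ j, β j) + σ2) := by
    rw [Finset.sum_mul, Finset.sum_mul]
    exact Finset.sum_congr rfl fun i _ => key i
  have hS : ∑ j, β j = ∑ j, β' j := by
    apply mul_right_cancel₀ hσ2.ne'
    linarith
  have hT : 0 < (∑ j, β' j) + σ2 :=
    add_pos_of_nonneg_of_pos (Finset.sum_nonneg fun j _ => hβ' j) hσ2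
  funext i
  have hk := key i
  rw [hS] at hk
  exact mul_right_cancel₀ hT.ne' hk
end

section
/- The rate map R is injective on its domain: if p, p' ∈ ℝ^N satisfy p_i ≥ c_i and p'_i ≥ c_i for all i ∈ N, and R_i(p) = R_i(p') for every i ∈ N, then p = p'. (Hence R admits an inverse operator from its image back to the power domain.) -/
/-- The rate map `R_i(p) = b_i log₂(1 + β_i(p) / (∑_{j≠i} β_j(p) + σ²))`, with
`β_i(p) = g_i (p_i - c_i) / d_i^{α_i}`, is injective on the domain
`{p : ∀ i, c_i ≤ p_i}`; hence it admits an inverse operator from its image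
back to the power domain. -/
theorem rate_map_injective
    {N : Type*} [Fintype N] [DecidableEq N]
    (σ2 : ℝ) (hσ2 : 0 < σ2)
    (b g d α c : N → ℝ)
    (hb : ∀ i, 0 < b i) (hg : ∀ i, 0 < g i) (hd : ∀ i, 0 < d i)
    (β : (N → ℝ) → N → ℝ)
    (hβ : ∀ q i, β q i = g i * (q i - c i) / (d i) ^ (α i))
    (R : (N → ℝ) → N → ℝ)
    (hR : ∀ q i, R q i
        = b i * Real.logb 2
            (1 + β q i / ((∑ j ∈ Finset.univ.erase i, β q j) + σ2)))
    (p p' : N → ℝ) (hp : ∀ i, c i ≤ p i) (hp' : ∀ i, c i ≤ p' i)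
    (h : ∀ i, R p i = R p' i) :
    p = p' := by
  have key : ∀ q : N → ℝ, (∀ i, c i ≤ q i) → ∀ i, 0 ≤ β q i := by
    intro q hq i
    rw [hβ]
    have h1 := sub_nonneg.mpr (hq i)
    have h2 := (hg i).le
    have h3 := (Real.rpow_pos_of_pos (hd i) (α i)).le
    positivity
  have hs : ∀ q : N → ℝ, ∀ i, (∑ j ∈ Finset.univ.erase i, β q j) = (∑ j, β q j) - β q i := by
    intro q i
    have := Finset.sum_erase_add Finset.univ (fun j => β q j) (Finset.mem_univ i)
    linarith
  have hn : ∀ q : N → ℝ, (∀ i, c i ≤ q i) → ∀ i,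
      0 < (∑ j ∈ Finset.univ.erase i, β q j) + σ2 := by
    intro q hq i
    have := Finset.sum_nonneg (fun j (_ : j ∈ Finset.univ.erase i) => key q hq j)
    linarith
  have hx : ∀ i, β p i * ((∑ j, β p' j) + σ2) = β p' i * ((∑ j, β p j) + σ2) := by
    intro i
    have h1 := h i
    rw [hR, hR] at h1
    have h2 := mul_left_cancel₀ (hb i).ne' h1
    have a := hn p hp i
    have a' := hn p' hp' i
    have e := key p hp i
    have e' := key p' hp' i
    have h3 := Real.logb_injOn_pos (by norm_num : (1:ℝ) < 2)
      (show _ ∈ Set.Ioi (0:ℝ) from by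
        show (0:ℝ) < _
        have := div_nonneg e a.le
        linarith) (show _ ∈ Set.Ioi (0:ℝ) from by
        show (0:ℝ) < _
        have := div_nonneg e' a'.le
        linarith) h2
    have h4 := add_left_cancel h3
    rw [div_eq_div_iff a.ne' a'.ne', hs, hs] at h4
    linarith
  have hsum : (∑ j, β p j) * ((∑ j, β p' j) + σ2) = (∑ j, β p' j) * ((∑ j, β p j) + σ2) := by
    rw [Finset.sum_mul, Finset.sum_mul]
    exact Finset.sum_congr rfl (fun i _ => hx i)
  have hT : (∑ j, β p j) = ∑ j, β p' j := by
    apply mul_right_cancel₀ hσ2.ne'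
    linarith
  funext i
  have h1 := hx i
  have hpos : 0 < (∑ j, β p' j) + σ2 := by
    have := Finset.sum_nonneg (fun j (_ : j ∈ Finset.univ) => key p' hp' j)
    linarith
  rw [hT] at h1
  have h2 := mul_right_cancel₀ hpos.ne' h1
  rw [hβ, hβ, div_left_inj' (Real.rpow_pos_of_pos (hd i) (α i)).ne'] at h2
  have h3 := mul_left_cancel₀ (hg i).ne' h2
  linarith
end

section
/- If β, β' ∈ ℝ^N have strictly positive entries and Λ_l(β) = Λ_l(β') for every l ∈ N, then for any fixed index i ∈ N and every l ∈ N one has β'_l = (β'_i / β_i) · β_l; that is, β' is a positive scalar multiple of β. -/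
/-- If `β, β'` have strictly positive entries and `Λ_l(β) = Λ_l(β')` for every
`l`, then for any fixed index `i` and every `l` one has
`β'_l = (β'_i / β_i) · β_l`, i.e. `β'` is a positive scalar multiple of `β`. -/
theorem sinr_eq_implies_scalar_multiple
    {N : Type*} [Fintype N] [DecidableEq N]
    (σ2 : ℝ) (hσ2 : 0 < σ2)
    (β β' : N → ℝ) (hβ : ∀ i, 0 < β i) (hβ' : ∀ i, 0 < β' i)
    (h : ∀ l, β l / ((∑ j ∈ Finset.univ.erase l, β j) + σ2)
            = β' l / ((∑ j ∈ Finset.univ.erase l, β' j) + σ2))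
    (i : N) :
    ∀ l, β' l = (β' i / β i) * β l := by
  have key : ∀ l, β l * ((∑ j, β' j) + σ2) = β' l * ((∑ j, β j) + σ2) := by
    intro l
    have h1 := h l
    have p : 0 ≤ ∑ j ∈ Finset.univ.erase l, β j := Finset.sum_nonneg fun j _ => (hβ j).le
    have p' : 0 ≤ ∑ j ∈ Finset.univ.erase l, β' j := Finset.sum_nonneg fun j _ => (hβ' j).le
    rw [div_eq_div_iff (by linarith) (by linarith)] at h1
    rw [← Finset.add_sum_erase Finset.univ β (Finset.mem_univ l),
      ← Finset.add_sum_erase Finset.univ β' (Finset.mem_univ l)]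
    linarith
  intro l
  have p : 0 ≤ ∑ j, β j := Finset.sum_nonneg fun j _ => (hβ j).le
  have hT : (∑ j, β j) + σ2 ≠ 0 := by linarith
  have hi := (hβ i).ne'
  rw [div_mul_eq_mul_div, eq_div_iff hi]
  apply mul_right_cancel₀ hT
  linear_combination β l * key i - β i * key l
end

section
/- Explicit inversion of the SINR map: let β ∈ ℝ^N have nonnegative entries and set γ_i = Λ_i(β) for each i ∈ N. Then ∑_{j∈N} γ_j/(1+γ_j) = S/(S+σ²) < 1, where S = ∑_{j∈N} β_j, and for every i ∈ N one has β_i = σ² · (γ_i/(1+γ_i)) / (1 − ∑_{j∈N} γ_j/(1+γ_j)). -/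
/-- Explicit inversion of the SINR map: with `γ_i = Λ_i(β)` and
`S = ∑_j β_j`, one has `∑_j γ_j/(1+γ_j) = S/(S+σ²) < 1` and
`β_i = σ² (γ_i/(1+γ_i)) / (1 - ∑_j γ_j/(1+γ_j))` for every `i`. -/
theorem sinr_map_explicit_inversion
    {N : Type*} [Fintype N] [DecidableEq N]
    (σ2 : ℝ) (hσ2 : 0 < σ2)
    (β : N → ℝ) (hβ : ∀ j, 0 ≤ β j)
    (γ : N → ℝ)
    (hγ : ∀ i, γ i = β i / ((∑ j ∈ Finset.univ.erase i, β j) + σ2))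
    (S : ℝ) (hS : S = ∑ j, β j) :
    (∑ j, γ j / (1 + γ j)) = S / (S + σ2)
      ∧ S / (S + σ2) < 1
      ∧ ∀ i, β i = σ2 * (γ i / (1 + γ i)) / (1 - ∑ j, γ j / (1 + γ j)) := by
  have hS0 : 0 ≤ S := hS ▸ Finset.sum_nonneg (fun j _ => hβ j)
  have hpos : 0 < S + σ2 := by linarith
  have key : ∀ i, γ i / (1 + γ i) = β i / (S + σ2) := by
    intro i
    have hE : 0 ≤ ∑ j ∈ Finset.univ.erase i, β j := Finset.sum_nonneg (fun j _ => hβ j)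
    have hsum : β i + ∑ j ∈ Finset.univ.erase i, β j = S := by
      rw [hS]; exact Finset.add_sum_erase _ _ (Finset.mem_univ i)
    rw [hγ i]
    generalize (∑ j ∈ Finset.univ.erase i, β j) = E at hE hsum
    have hD : E + σ2 ≠ 0 := by positivity
    have h1 : 1 + β i / (E + σ2) = (S + σ2) / (E + σ2) := by
      rw [← hsum, eq_div_iff hD, add_mul, div_mul_cancel₀ _ hD]; ring
    rw [h1, div_div_div_cancel_right₀ hD]
  have hsum : (∑ j, γ j / (1 + γ j)) = S / (S + σ2) := by
    rw [Finset.sum_congr rfl (fun j _ => key j), ← Finset.sum_div, ← hS]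
  refine ⟨hsum, ?_, fun i => ?_⟩
  · rw [div_lt_one hpos]; linarith
  · have h2 : 1 - S / (S + σ2) = σ2 / (S + σ2) := by
      rw [eq_div_iff hpos.ne', sub_mul, div_mul_cancel₀ _ hpos.ne']; ring
    rw [hsum, key i, h2, ← mul_div_assoc, div_div_div_cancel_right₀ hpos.ne',
      mul_div_cancel_left₀ _ hσ2.ne']
end

section
/- The SINR map Λ restricted to the nonnegative orthant {β ∈ ℝ^N : β_i ≥ 0 for all i} is a bijection onto the set Γ = {γ ∈ ℝ^N : γ_i ≥ 0 for all i and ∑_{j∈N} γ_j/(1+γ_j) < 1}. -/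
theorem sinr_aux {N : Type*} [Fintype N] [DecidableEq N] (σ2 : ℝ) (hσ2 : 0 < σ2)
    (β : N → ℝ) (hβ : ∀ i, 0 ≤ β i) (i : N) :
    0 ≤ β i / ((∑ j ∈ Finset.univ.erase i, β j) + σ2) ∧
    (β i / ((∑ j ∈ Finset.univ.erase i, β j) + σ2)) /
      (1 + β i / ((∑ j ∈ Finset.univ.erase i, β j) + σ2)) = β i / ((∑ j, β j) + σ2) := by
  have h0 : 0 ≤ ∑ j ∈ Finset.univ.erase i, β j := Finset.sum_nonneg fun j _ => hβ j
  have hi := hβ i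
  rw [← Finset.add_sum_erase _ _ (Finset.mem_univ i)]
  generalize (∑ j ∈ Finset.univ.erase i, β j) = E at *
  refine ⟨by positivity, ?_⟩
  have h1 : E + σ2 ≠ 0 := by positivity
  have h2 : β i + E + σ2 ≠ 0 := by positivity
  have h3 : 1 + β i / (E + σ2) = (β i + E + σ2) / (E + σ2) := by field_simp; ring
  rw [h3]
  field_simp

/-- The SINR map `Λ` restricted to the nonnegative orthant is a bijection
onto `Γ = {γ : ∀ i, γ_i ≥ 0 and ∑_j γ_j/(1+γ_j) < 1}`. -/
theorem sinr_map_bijective_on_nonneg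
    {N : Type*} [Fintype N] [DecidableEq N]
    (σ2 : ℝ) (hσ2 : 0 < σ2) :
    Set.BijOn
      (fun (β : N → ℝ) (i : N) =>
        β i / ((∑ j ∈ Finset.univ.erase i, β j) + σ2))
      {β : N → ℝ | ∀ i, 0 ≤ β i}
      {γ : N → ℝ | (∀ i, 0 ≤ γ i) ∧ (∑ j, γ j / (1 + γ j)) < 1} := by
  refine Set.InvOn.bijOn (f' := fun (γ : N → ℝ) (i : N) =>
    γ i / (1 + γ i) * (σ2 / (1 - ∑ j, γ j / (1 + γ j)))) ⟨?_, ?_⟩ ?_ ?_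
  · intro β hβ
    funext i
    have h0 : 0 ≤ ∑ j, β j := Finset.sum_nonneg fun j _ => hβ j
    simp only [fun i => (sinr_aux σ2 hσ2 β hβ i).2, ← Finset.sum_div]
    generalize (∑ j, β j) = S at *
    have h1 : S + σ2 ≠ 0 := by positivity
    have h3 : 1 - S / (S + σ2) = σ2 / (S + σ2) := by field_simp; ring
    rw [h3]
    field_simp
  · rintro γ ⟨hγ, hP⟩
    funext i
    have hi := hγ i
    have hs := Finset.add_sum_erase Finset.univ (fun j => γ j / (1 + γ j)) (Finset.mem_univ i)
    simp only [← Finset.sum_mul] at hs ⊢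
    generalize (∑ j, γ j / (1 + γ j)) = P at *
    have h1 : 1 - P ≠ 0 := by linarith
    have h2 : 1 + γ i ≠ 0 := by positivity
    have h3 : (∑ j ∈ Finset.univ.erase i, γ j / (1 + γ j)) * (σ2 / (1 - P)) + σ2
        = (σ2 / (1 - P)) / (1 + γ i) := by
      rw [eq_sub_of_add_eq' hs]
      field_simp
      ring
    rw [h3]
    field_simp
  · intro β hβ
    refine ⟨fun i => (sinr_aux σ2 hσ2 β hβ i).1, ?_⟩
    have h0 : 0 ≤ ∑ j, β j := Finset.sum_nonneg fun j _ => hβ j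
    simp only [fun i => (sinr_aux σ2 hσ2 β hβ i).2, ← Finset.sum_div]
    rw [div_lt_one (by positivity)]
    linarith
  · rintro γ ⟨hγ, hP⟩ i
    have hi := hγ i
    have : 0 < 1 - ∑ j, γ j / (1 + γ j) := by linarith
    exact mul_nonneg (by positivity) (div_nonneg hσ2.le this.le)
end

section
/- Let b > 0, σ² > 0, and X ∈ [0, 1), and define F : ℝ → ℝ by F(r) = σ² · (1 − 2^{−r/b}) / (2^{−r/b} − X). Then F is strictly increasing and strictly convex on the interval {r ≥ 0 : 2^{−r/b} > X} (which equals [0, ∞) when X = 0 and [0, b·log₂(1/X)) when X > 0). -/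
lemma aux_mono (X v w : ℝ) (hX1 : X < 1) (hvw : v < w) (hv : X * v < 1) (hw : X * w < 1) :
    (v - 1) / (1 - X * v) < (w - 1) / (1 - X * w) := by
  rw [div_lt_div_iff₀ (by linarith) (by linarith)]
  nlinarith [mul_pos (sub_pos.2 hX1) (sub_pos.2 hvw)]

lemma aux_tangent (X m w : ℝ) (hX0 : 0 ≤ X) (hX1 : X < 1) (hm : X * m < 1) (hw : X * w < 1) :
    (m - 1) / (1 - X * m) + (1 - X) / (1 - X * m) ^ 2 * (w - m) ≤ (w - 1) / (1 - X * w) := by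
  have h1 : 0 < 1 - X * m := by linarith
  have h2 : 0 < 1 - X * w := by linarith
  have h3 : 0 < 1 - X := by linarith
  have key : (w - 1) / (1 - X * w) -
      ((m - 1) / (1 - X * m) + (1 - X) / (1 - X * m) ^ 2 * (w - m)) =
      (1 - X) * X * (w - m) ^ 2 / ((1 - X * w) * (1 - X * m) ^ 2) := by
    have h1' := h1.ne'
    have h2' : 1 - w * X ≠ 0 := by rw [mul_comm]; exact h2.ne'
    field_simp
    ring
  have : 0 ≤ (1 - X) * X * (w - m) ^ 2 / ((1 - X * w) * (1 - X * m) ^ 2) := by positivity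
  linarith

/-- For `b > 0`, `σ² > 0`, `X ∈ [0, 1)`, the function
`F(r) = σ² (1 - 2^{-r/b}) / (2^{-r/b} - X)` is strictly increasing and
strictly convex on `{r ≥ 0 : 2^{-r/b} > X}`. -/
theorem inverse_rate_power_strictMono_strictConvex
    (b σ2 X : ℝ) (hb : 0 < b) (hσ2 : 0 < σ2) (hX : X ∈ Set.Ico (0 : ℝ) 1) :
    StrictMonoOn
        (fun r : ℝ => σ2 * (1 - (2 : ℝ) ^ (-(r / b))) / ((2 : ℝ) ^ (-(r / b)) - X))
        {r : ℝ | 0 ≤ r ∧ X < (2 : ℝ) ^ (-(r / b))}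
      ∧ StrictConvexOn ℝ
          {r : ℝ | 0 ≤ r ∧ X < (2 : ℝ) ^ (-(r / b))}
          (fun r : ℝ => σ2 * (1 - (2 : ℝ) ^ (-(r / b))) / ((2 : ℝ) ^ (-(r / b)) - X)) := by
  obtain ⟨hX0, hX1⟩ := hX
  obtain ⟨c, hc⟩ : ∃ c, c = Real.log 2 / b := ⟨_, rfl⟩
  have hc0 : 0 < c := hc ▸ div_pos (Real.log_pos (by norm_num)) hb
  have hu : ∀ r : ℝ, (2 : ℝ) ^ (-(r / b)) = (Real.exp (c * r))⁻¹ := by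
    intro r
    rw [Real.rpow_def_of_pos (by norm_num), ← Real.exp_neg, hc]
    congr 1
    ring
  have hF : ∀ r : ℝ, σ2 * (1 - (Real.exp (c * r))⁻¹) / ((Real.exp (c * r))⁻¹ - X)
      = σ2 * ((Real.exp (c * r) - 1) / (1 - X * Real.exp (c * r))) := by
    intro r
    have h := Real.exp_pos (c * r)
    rw [← mul_div_mul_right _ _ h.ne', ← mul_div_assoc]
    congr 1
    · field_simp
    · field_simp
  have hS : ∀ r : ℝ, X < (Real.exp (c * r))⁻¹ ↔ X * Real.exp (c * r) < 1 := by
    intro r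
    rw [← one_div, lt_div_iff₀ (Real.exp_pos _)]
  simp only [hu, hF, hS]
  have hconv : ∀ x y s t : ℝ, 0 ≤ s → 0 ≤ t → s + t = 1 →
      Real.exp (c * (s * x + t * y)) ≤ s * Real.exp (c * x) + t * Real.exp (c * y) := by
    intro x y s t hs ht hst
    have := convexOn_exp.2 (Set.mem_univ (c * x)) (Set.mem_univ (c * y)) hs ht hst
    simp only [smul_eq_mul] at this
    rwa [show s * (c * x) + t * (c * y) = c * (s * x + t * y) by ring] at this
  have hm : ∀ v w s t : ℝ, X * v < 1 → X * w < 1 → 0 ≤ s → 0 ≤ t → s + t = 1 →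
      X * (s * v + t * w) < 1 := by
    intro v w s t hv hw hs ht hst
    have := (convex_Iio (1 : ℝ)) (Set.mem_Iio.2 hv) (Set.mem_Iio.2 hw) hs ht hst
    simp only [smul_eq_mul, Set.mem_Iio] at this
    linarith
  refine ⟨?_, ?_, ?_⟩
  · rintro x ⟨_, hx⟩ y ⟨_, hy⟩ hxy
    exact mul_lt_mul_of_pos_left (aux_mono X _ _ hX1
      (Real.exp_lt_exp.2 (mul_lt_mul_of_pos_left hxy hc0)) hx hy) hσ2
  · rintro x ⟨hx0, hx⟩ y ⟨hy0, hy⟩ s t hs ht hst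
    simp only [smul_eq_mul, Set.mem_ofPred_eq]
    exact ⟨by positivity, lt_of_le_of_lt
      (mul_le_mul_of_nonneg_left (hconv x y s t hs ht hst) hX0) (hm _ _ s t hx hy hs ht hst)⟩
  · rintro x ⟨hx0, hx⟩ y ⟨hy0, hy⟩ hxy s t hs ht hst
    simp only [smul_eq_mul]
    have hlt : Real.exp (c * (s * x + t * y)) < s * Real.exp (c * x) + t * Real.exp (c * y) := by
      have := strictConvexOn_exp.2 (Set.mem_univ (c * x)) (Set.mem_univ (c * y))
        (fun h => hxy (mul_left_cancel₀ hc0.ne' h)) hs ht hst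
      simp only [smul_eq_mul] at this
      rwa [show s * (c * x) + t * (c * y) = c * (s * x + t * y) by ring] at this
    have hmm := hm _ _ s t hx hy hs.le ht.le hst
    have h0 := lt_of_le_of_lt (mul_le_mul_of_nonneg_left hlt.le hX0) hmm
    have h1 := aux_mono X _ _ hX1 hlt h0 hmm
    have h2 := mul_le_mul_of_nonneg_left (aux_tangent X _ _ hX0 hX1 hmm hx) hs.le
    have h3 := mul_le_mul_of_nonneg_left (aux_tangent X _ _ hX0 hX1 hmm hy) ht.le
    generalize Real.exp (c * x) = v at *
    generalize Real.exp (c * y) = w at *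
    obtain rfl : t = 1 - s := by linarith
    have h4 := mul_lt_mul_of_pos_left h1 hσ2
    have h5 := mul_le_mul_of_nonneg_left (add_le_add h2 h3) hσ2.le
    refine lt_of_lt_of_le h4 (le_trans (le_of_eq ?_) (le_trans h5 (le_of_eq ?_)))
    · ring
    · ring
end

section
/- Let a, c, m ∈ ℝ satisfy a m² ≥ c ≥ 0, let b ∈ ℝ, and let t ≥ 0. Then the cost-share function C(r) = r · (a m² (r + t) + b m + c/(r + t)) is convex on the set {r ≥ 0 : r + t ≥ 1}. -/
/-- If `a m² ≥ c ≥ 0` and `t ≥ 0`, the cost-share function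
`C(r) = r (a m² (r+t) + b m + c/(r+t))` is convex on `{r ≥ 0 : r + t ≥ 1}`. -/
theorem cost_share_convex
    (a b c m t : ℝ)
    (hac : c ≤ a * m ^ 2) (hc : 0 ≤ c) (ht : 0 ≤ t) :
    ConvexOn ℝ {r : ℝ | 0 ≤ r ∧ 1 ≤ r + t}
      (fun r : ℝ => r * (a * m ^ 2 * (r + t) + b * m + c / (r + t))) := by
  have hset : Convex ℝ {r : ℝ | 0 ≤ r ∧ 1 ≤ r + t} := by
    rintro x ⟨hx, hx1⟩ y ⟨hy, hy1⟩ p q hp hq hpq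
    simp only [smul_eq_mul, Set.mem_setOf_eq]
    refine ⟨by positivity, ?_⟩
    obtain rfl : q = 1 - p := by linarith
    nlinarith [mul_nonneg hp (sub_nonneg.2 hx1), mul_nonneg hq (sub_nonneg.2 hy1)]
  refine ⟨hset, ?_⟩
  intro x hx' y hy' p q hp hq hpq
  obtain ⟨hw0, hw⟩ := hset hx' hy' hp hq hpq
  obtain ⟨hx, hx1⟩ := hx'
  obtain ⟨hy, hy1⟩ := hy'
  simp only [smul_eq_mul] at *
  have h1 : (1:ℝ) ≤ (y + t) * (p * x + q * y + t) := one_le_mul_of_one_le_of_one_le hy1 hw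
  have h2 : t ≤ (x + t) * ((y + t) * (p * x + q * y + t)) := by nlinarith
  have h3 : t / ((x + t) * ((y + t) * (p * x + q * y + t))) ≤ 1 :=
    div_le_one_of_le₀ h2 (by linarith)
  have h4 : 0 ≤ a * m ^ 2 - c * (t / ((x + t) * ((y + t) * (p * x + q * y + t)))) := by
    nlinarith [mul_le_mul_of_nonneg_left h3 hc]
  have h5 : 0 ≤ p * q * (x - y) ^ 2 *
      (a * m ^ 2 - c * (t / ((x + t) * ((y + t) * (p * x + q * y + t))))) := by positivity
  have hxn : x + t ≠ 0 := by linarith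
  have hyn : y + t ≠ 0 := by linarith
  have hwn : p * x + q * y + t ≠ 0 := by linarith
  have key : p * (x * (a * m ^ 2 * (x + t) + b * m + c / (x + t)))
      + q * (y * (a * m ^ 2 * (y + t) + b * m + c / (y + t)))
      - (p * x + q * y) * (a * m ^ 2 * (p * x + q * y + t) + b * m + c / (p * x + q * y + t))
      = p * q * (x - y) ^ 2 *
      (a * m ^ 2 - c * (t / ((x + t) * ((y + t) * (p * x + q * y + t))))) := by
    obtain rfl : q = 1 - p := by linarith
    field_simp
    ring
  linarith
end

section
/- Fix constants λ > 0, φ > 0, D > 0, η ∈ ℝ, b > 0, g > 0, d > 0, α ∈ ℝ, c₀ ∈ ℝ, σ² > 0, m > 0, and a, bc, c ∈ ℝ with a m² ≥ c ≥ 0. Fix X ∈ [0, 1) and t ≥ 0, and define u : ℝ → ℝ by u(r) = λ r − φ D^η · (c₀ + (d^α/g) · σ² (1 − 2^{−r/b}) / (2^{−r/b} − X)) − r · (a m² (r + t) + bc · m + c/(r + t)). Then u is strictly concave on the set {r ≥ 0 : r + t ≥ 1 and 2^{−r/b} > X}. -/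
theorem aux_h (X y v : ℝ) (hX : 0 ≤ X) (hy : X * y < 1) (hv : X * v < 1) :
    v / (1 - X * v) + (y - v) / (1 - X * v) ^ 2 ≤ y / (1 - X * y) := by
  have h1 : 0 < 1 - X * y := by linarith
  have h2 : 0 < 1 - X * v := by linarith
  have : y / (1 - X * y) - (v / (1 - X * v) + (y - v) / (1 - X * v) ^ 2)
      = X * (y - v) ^ 2 / ((1 - X * y) * (1 - X * v) ^ 2) := by
    obtain ⟨w, hw⟩ : ∃ w, w = 1 - X * y := ⟨_, rfl⟩
    obtain ⟨w', hw'⟩ : ∃ w, w = 1 - X * v := ⟨_, rfl⟩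
    rw [← hw] at h1 ⊢
    rw [← hw'] at h2 ⊢
    field_simp
    subst hw hw'
    ring
  have h3 : 0 ≤ X * (y - v) ^ 2 / ((1 - X * y) * (1 - X * v) ^ 2) := by positivity
  linarith

theorem aux_G (A B c t r z : ℝ) (hA : c ≤ A) (hc : 0 ≤ c) (ht : 0 ≤ t) (hr : 0 ≤ r)
    (hrt : 1 ≤ r + t) (hzt : 1 ≤ z + t) :
    z * (A * (z + t) + B + c / (z + t))
      + (2 * A * z + A * t + B + c * t / (z + t) ^ 2) * (r - z)
      ≤ r * (A * (r + t) + B + c / (r + t)) := by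
  have h1 : 0 < r + t := by linarith
  have h2 : 0 < z + t := by linarith
  have e : r * (A * (r + t) + B + c / (r + t)) - (z * (A * (z + t) + B + c / (z + t))
      + (2 * A * z + A * t + B + c * t / (z + t) ^ 2) * (r - z))
      = (A - c * (t / ((r + t) * (z + t) ^ 2))) * (r - z) ^ 2 := by
    field_simp
    ring
  have h3 : t / ((r + t) * (z + t) ^ 2) ≤ 1 := by
    rw [div_le_one (by positivity)]
    have : 1 ≤ (z + t) ^ 2 := by nlinarith
    nlinarith
  have h4 : 0 ≤ (A - c * (t / ((r + t) * (z + t) ^ 2))) * (r - z) ^ 2 := by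
    apply mul_nonneg _ (sq_nonneg _)
    nlinarith
  linarith

theorem aux_P (b X r : ℝ) (hr : X < (2 : ℝ) ^ (-(r / b))) :
    (1 - (2 : ℝ) ^ (-(r / b))) / ((2 : ℝ) ^ (-(r / b)) - X)
      = -1 + (1 - X) * ((2 : ℝ) ^ (r / b) / (1 - X * (2 : ℝ) ^ (r / b))) := by
  rw [Real.rpow_neg (by norm_num)] at *
  have hy : (0 : ℝ) < (2 : ℝ) ^ (r / b) := by positivity
  generalize (2 : ℝ) ^ (r / b) = y at *
  have h1 : X * y < 1 := by rwa [← one_div, lt_div_iff₀ hy] at hr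
  have h2 : 1 - X * y ≠ 0 := by linarith
  have h3 : y⁻¹ - X ≠ 0 := by linarith
  have h4 : y⁻¹ - X = (1 - X * y) / y := by field_simp
  rw [h4]
  obtain ⟨w, hw⟩ : ∃ w, w = 1 - X * y := ⟨_, rfl⟩
  rw [← hw] at h2 ⊢
  field_simp
  subst hw
  ring

theorem aux_dom (b X r : ℝ) : X < (2 : ℝ) ^ (-(r / b)) ↔ X * (2 : ℝ) ^ (r / b) < 1 := by
  have hy : (0 : ℝ) < (2 : ℝ) ^ (r / b) := by positivity
  rw [Real.rpow_neg (by norm_num), ← one_div, lt_div_iff₀ hy]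

theorem aux_conv (b : ℝ) (hb : 0 < b) :
    StrictConvexOn ℝ Set.univ (fun r : ℝ => (2 : ℝ) ^ (r / b)) := by
  refine ⟨convex_univ, ?_⟩
  intro x _ y _ hxy p q hp hq hpq
  have hl : 0 < Real.log 2 := Real.log_pos (by norm_num)
  have hne : Real.log 2 * (x / b) ≠ Real.log 2 * (y / b) := by
    intro h
    apply hxy
    have := mul_left_cancel₀ hl.ne' h
    field_simp at this
    exact this
  have := strictConvexOn_exp.2 (Set.mem_univ _) (Set.mem_univ _) hne hp hq hpq
  simp only [smul_eq_mul, Real.rpow_def_of_pos (show (0 : ℝ) < 2 by norm_num)] at *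
  convert this using 2
  ring

/-- Strict concavity of a sensor's utility in its own transmission rate, with
the other sensors' strategies fixed (via `X = ∑_{j≠i}(1 - 2^{-r_j/b_j})` and
`t = ∑_{j≠i} r_j`), on the set `{r ≥ 0 : r + t ≥ 1 and 2^{-r/b} > X}`. -/
theorem utility_strictly_concave
    (lam φ D η b g d α c0 σ2 m a bc c X t : ℝ)
    (hlam : 0 < lam) (hφ : 0 < φ) (hD : 0 < D) (hb : 0 < b) (hg : 0 < g)
    (hd : 0 < d) (hσ2 : 0 < σ2) (hm : 0 < m)
    (hac : c ≤ a * m ^ 2) (hc : 0 ≤ c)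
    (hX : X ∈ Set.Ico (0 : ℝ) 1) (ht : 0 ≤ t) :
    StrictConcaveOn ℝ
      {r : ℝ | 0 ≤ r ∧ 1 ≤ r + t ∧ X < (2 : ℝ) ^ (-(r / b))}
      (fun r : ℝ =>
        lam * r
          - φ * D ^ η *
              (c0 + (d ^ α / g) * σ2 * (1 - (2 : ℝ) ^ (-(r / b)))
                      / ((2 : ℝ) ^ (-(r / b)) - X))
          - r * (a * m ^ 2 * (r + t) + bc * m + c / (r + t))) := by
  obtain ⟨hX0, hX1⟩ := hX
  have hdom : ∀ x y p q : ℝ, X * (2 : ℝ) ^ (x / b) < 1 → X * (2 : ℝ) ^ (y / b) < 1 →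
      0 ≤ p → 0 ≤ q → p + q = 1 →
      X * (p * (2 : ℝ) ^ (x / b) + q * (2 : ℝ) ^ (y / b)) < 1 := by
    intro x y p q hx hy hp hq hpq
    have := (convex_Iio (1 : ℝ)) hx hy hp hq hpq
    simp only [smul_eq_mul, Set.mem_Iio] at this
    linarith
  have hset : ∀ x y p q : ℝ, (0 ≤ x ∧ 1 ≤ x + t ∧ X < (2 : ℝ) ^ (-(x / b))) →
      (0 ≤ y ∧ 1 ≤ y + t ∧ X < (2 : ℝ) ^ (-(y / b))) →
      0 ≤ p → 0 ≤ q → p + q = 1 →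
      (0 ≤ p * x + q * y ∧ 1 ≤ p * x + q * y + t ∧
        X < (2 : ℝ) ^ (-((p * x + q * y) / b))) := by
    rintro x y p q ⟨hx0, hxt, hx⟩ ⟨hy0, hyt, hy⟩ hp hq hpq
    refine ⟨by positivity, ?_, ?_⟩
    · obtain rfl : q = 1 - p := by linarith
      nlinarith
    · rw [aux_dom] at *
      refine lt_of_le_of_lt ?_ (hdom x y p q hx hy hp hq hpq)
      apply mul_le_mul_of_nonneg_left _ hX0
      have := (aux_conv b hb).convexOn.2 (Set.mem_univ x) (Set.mem_univ y) hp hq hpq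
      simpa only [smul_eq_mul] using this
  constructor
  · intro x hx y hy p q hp hq hpq
    exact hset x y p q hx hy hp hq hpq
  intro x hx y hy hxy p q hp hq hpq
  have hz := hset x y p q hx hy hp.le hq.le hpq
  obtain ⟨hx0, hxt, hx⟩ := hx
  obtain ⟨hy0, hyt, hy⟩ := hy
  obtain ⟨hz0, hzt, hz⟩ := hz
  simp only [smul_eq_mul]
  have gx := aux_G (a * m ^ 2) (bc * m) c t x (p * x + q * y) hac hc ht hx0 hxt hzt
  have gy := aux_G (a * m ^ 2) (bc * m) c t y (p * x + q * y) hac hc ht hy0 hyt hzt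
  have hlt := (aux_conv b hb).2 (Set.mem_univ x) (Set.mem_univ y) hxy hp hq hpq
  simp only [smul_eq_mul] at hlt
  simp only [mul_div_assoc (d ^ α / g * σ2)]
  rw [aux_P b X x hx, aux_P b X y hy, aux_P b X _ hz]
  rw [aux_dom] at hx hy hz
  have hv := hdom x y p q hx hy hp.le hq.le hpq
  have hx' := aux_h X _ _ hX0 hx hv
  have hy' := aux_h X _ _ hX0 hy hv
  have hz' : (2 : ℝ) ^ ((p * x + q * y) / b) / (1 - X * (2 : ℝ) ^ ((p * x + q * y) / b))
      < (p * (2 : ℝ) ^ (x / b) + q * (2 : ℝ) ^ (y / b)) /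
        (1 - X * (p * (2 : ℝ) ^ (x / b) + q * (2 : ℝ) ^ (y / b))) := by
    rw [div_lt_div_iff₀ (by linarith) (by linarith)]
    nlinarith
  have hK : 0 < φ * D ^ η * (d ^ α / g * σ2) * (1 - X) := by
    have : 0 < 1 - X := by linarith
    positivity
  generalize (2 : ℝ) ^ ((p * x + q * y) / b) / (1 - X * (2 : ℝ) ^ ((p * x + q * y) / b))
    = Hz at *
  generalize (2 : ℝ) ^ (x / b) / (1 - X * (2 : ℝ) ^ (x / b)) = Hx at *
  generalize (2 : ℝ) ^ (y / b) / (1 - X * (2 : ℝ) ^ (y / b)) = Hy at *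
  have hH : Hz < p * Hx + q * Hy := by
    refine lt_of_lt_of_le hz' ?_
    have e1 := mul_le_mul_of_nonneg_left hx' hp.le
    have e2 := mul_le_mul_of_nonneg_left hy' hq.le
    refine le_trans (le_of_eq ?_) (add_le_add e1 e2)
    obtain rfl : q = 1 - p := by linarith
    ring
  have hG : (p * x + q * y) * (a * m ^ 2 * (p * x + q * y + t) + bc * m + c / (p * x + q * y + t))
      ≤ p * (x * (a * m ^ 2 * (x + t) + bc * m + c / (x + t)))
        + q * (y * (a * m ^ 2 * (y + t) + bc * m + c / (y + t))) := by
    have e1 := mul_le_mul_of_nonneg_left gx hp.le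
    have e2 := mul_le_mul_of_nonneg_left gy hq.le
    refine le_trans (le_of_eq ?_) (add_le_add e1 e2)
    obtain rfl : q = 1 - p := by linarith
    ring
  have hKH := mul_lt_mul_of_pos_left hH hK
  generalize x * (a * m ^ 2 * (x + t) + bc * m + c / (x + t)) = Gx at *
  generalize y * (a * m ^ 2 * (y + t) + bc * m + c / (y + t)) = Gy at *
  generalize (p * x + q * y) * (a * m ^ 2 * (p * x + q * y + t) + bc * m
    + c / (p * x + q * y + t)) = Gz at *
  obtain rfl : q = 1 - p := by linarith
  linear_combination hKH + hG
end

section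
/- Under the conditions a m² ≥ c ≥ 0, ∑_{j∈N} ℓ_j ≥ 1, and ∑_{j∈N} (1 − 2^{−h_j/b_j}) < 1, the noncooperative rate-selection game admits a Nash equilibrium: there exists r* ∈ ∏_{i∈N} [ℓ_i, h_i] such that for every i ∈ N and every r_i ∈ [ℓ_i, h_i], u_i(r_i, r*_{−i}) ≤ u_i(r*_i, r*_{−i}). -/
section Helpers
open MeasureTheory Metric Set Filter Topology

section Brouwer
variable {E : Type*} [NormedAddCommGroup E] [InnerProductSpace ℝ E] [FiniteDimensional ℝ E]

lemma det_poly (B : E →L[ℝ] E) : ∃ p : Polynomial ℝ, p.natDegree ≤ Module.finrank ℝ E ∧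
    ∀ t : ℝ, p.eval t = (ContinuousLinearMap.id ℝ E + t • B).det := by
  classical
  let bs := Module.finBasis ℝ E
  let M := LinearMap.toMatrix bs bs (B : E →ₗ[ℝ] E)
  refine ⟨Matrix.det ((Polynomial.X : Polynomial ℝ) • M.map Polynomial.C +
    (1 : Matrix _ _ ℝ).map Polynomial.C), ?_, ?_⟩
  · exact (Polynomial.natDegree_det_X_add_C_le M 1).trans (by simp)
  · intro t
    rw [ContinuousLinearMap.det, ← LinearMap.det_toMatrix bs, ← Polynomial.coe_evalRingHom,
      RingHom.map_det]
    congr 1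
    ext i j
    by_cases hij : i = j <;>
    (simp [M, hij, LinearMap.toMatrix_apply, add_comm]; ring)

/-- A family of weights extrapolating polynomials. -/
lemma extrap (n : ℕ) (δ : ℝ) (hδ : 0 < δ) : ∃ (v w : ℕ → ℝ), (∀ k ∈ Finset.range (n+1), 0 < v k ∧ v k < δ) ∧
    (∑ k ∈ Finset.range (n+1), w k = 1) ∧
    ∀ p : Polynomial ℝ, p.natDegree ≤ n → p.eval 1 = ∑ k ∈ Finset.range (n+1), w k * p.eval (v k) := by
  let v : ℕ → ℝ := fun k => δ / (k + 2)
  have hv : Function.Injective v := by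
    intro a b hab
    simp only [v] at hab
    have : (a:ℝ) + 2 = b + 2 := by
      field_simp at hab
      linarith
    exact_mod_cast (by linarith : (a:ℝ) = b)
  have key : ∀ p : Polynomial ℝ, p.natDegree ≤ n → p.eval 1 = ∑ k ∈ Finset.range (n+1),
      (Lagrange.basis (Finset.range (n+1)) v k).eval 1 * p.eval (v k) := by
    intro p hp
    have := Lagrange.eq_interpolate (f := p) (s := Finset.range (n+1)) (v := v) hv.injOn (by
      rw [Finset.card_range]
      exact (Polynomial.degree_le_natDegree).trans_lt (by exact_mod_cast Nat.lt_succ_of_le hp))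
    conv_lhs => rw [this]
    rw [Lagrange.interpolate_apply, Polynomial.eval_finsetSum]
    refine Finset.sum_congr rfl fun k _ => ?_
    simp [mul_comm]
  refine ⟨v, fun k => (Lagrange.basis (Finset.range (n+1)) v k).eval 1, ?_, ?_, key⟩
  · intro k _
    refine ⟨by positivity, ?_⟩
    apply div_lt_self hδ
    have : (0:ℝ) ≤ k := k.cast_nonneg
    linarith
  · have := key 1 (by simp)
    simpa using this.symm

lemma no_retract (ρ : ℝ) (hρ : 0 < ρ) (f : E → E) (U : Set E) (hUo : IsOpen U)
    (hU : closedBall (0:E) ρ ⊆ U) (hf : ContDiffOn ℝ 1 f U)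
    (h1 : ∀ x ∈ closedBall (0:E) ρ, ‖f x‖ = ρ) (h2 : ∀ x, ‖x‖ = ρ → f x = x) : False := by
  borelize E
  let μ : Measure E := Measure.addHaar
  let v : E → E := fun x => f x - x
  have hv : ContDiffOn ℝ 1 v U := hf.sub contDiffOn_id
  have hfD : ∀ x ∈ U, HasFDerivAt v (fderiv ℝ v x) x := fun x hx =>
    ((hv.contDiffAt (hUo.mem_nhds hx)).differentiableAt (by simp)).hasFDerivAt
  have hfS : ∀ x ∈ U, HasStrictFDerivAt v (fderiv ℝ v x) x := fun x hx =>
    ((hv.contDiffAt (hUo.mem_nhds hx)).hasStrictFDerivAt (by simp))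
  have hcont : ContinuousOn (fderiv ℝ v) (closedBall 0 ρ) :=
    (hv.continuousOn_fderiv_of_isOpen hUo (by simp)).mono hU
  obtain ⟨C, hC⟩ := (isCompact_closedBall (0:E) ρ).exists_bound_of_continuousOn hcont
  have hLip : ∀ x ∈ closedBall (0:E) ρ, ∀ y ∈ closedBall (0:E) ρ, ‖v y - v x‖ ≤ C * ‖y - x‖ :=
    fun x hx y hy => (convex_closedBall (0:E) ρ).norm_image_sub_le_of_norm_hasFDerivWithin_le
      (fun z hz => (hfD z (hU hz)).hasFDerivWithinAt) hC hx hy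
  have hC0 : 0 ≤ C := (norm_nonneg _).trans (hC 0 (by simp [hρ.le]))
  have hdet : ∀ᶠ A in 𝓝 (ContinuousLinearMap.id ℝ E), 0 < A.det := by
    have := (ContinuousLinearMap.continuous_det (𝕜 := ℝ) (E := E)).tendsto (ContinuousLinearMap.id ℝ E)
    apply this.eventually (lt_mem_nhds _)
    simp [ContinuousLinearMap.det]
  obtain ⟨ε, hε, hεd⟩ := Metric.eventually_nhds_iff.1 hdet
  let J : ℝ → E → ℝ := fun t x => (ContinuousLinearMap.id ℝ E + t • fderiv ℝ v x).det
  let δ := min (min (1/2) (1 / (C+1))) (ε / (C+1))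
  have hδ : 0 < δ := by positivity
  have main : ∀ t, 0 < t → t < δ → ∫ x in ball (0:E) ρ, J t x ∂μ = μ.real (ball 0 ρ) := by
    intro t ht htδ
    have t1 : t < 1/2 := htδ.trans_le ((min_le_left _ _).trans (min_le_left _ _))
    have t2 : t * (C+1) < 1 := by
      rw [← lt_div_iff₀ (by positivity)]
      exact htδ.trans_le ((min_le_left _ _).trans (min_le_right _ _))
    have t3 : t * (C+1) < ε := by
      rw [← lt_div_iff₀ (by positivity)]
      exact htδ.trans_le (min_le_right _ _)
    let F : E → E := fun x => x + t • v x
    have hF : ∀ x ∈ U, HasStrictFDerivAt F (ContinuousLinearMap.id ℝ E + t • fderiv ℝ v x) x :=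
      fun x hx => (hasStrictFDerivAt_id x).add ((hfS x hx).const_smul t)
    have hJ : ∀ x ∈ closedBall (0:E) ρ, 0 < J t x := by
      intro x hx
      apply hεd
      rw [dist_eq_norm, add_sub_cancel_left, norm_smul, Real.norm_of_nonneg ht.le]
      nlinarith [hC x hx]
    have hinj : InjOn F (closedBall 0 ρ) := by
      intro x hx y hy hxy
      have e : y - x = - (t • (v y - v x)) := by
        simp only [F] at hxy
        have h3 : x = y + t • v y - t • v x := eq_sub_of_add_eq hxy
        rw [smul_sub]
        conv_lhs => rw [h3]
        abel
      have e2 : ‖y - x‖ ≤ t * (C * ‖y - x‖) := by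
        conv_lhs => rw [e]
        rw [norm_neg, norm_smul, Real.norm_of_nonneg ht.le]
        exact mul_le_mul_of_nonneg_left (hLip x hx y hy) ht.le
      have : ‖y - x‖ = 0 := by
        by_contra hne
        have : 0 < ‖y - x‖ := lt_of_le_of_ne (norm_nonneg _) (Ne.symm hne)
        nlinarith
      exact (sub_eq_zero.1 (norm_eq_zero.1 this)).symm
    have hFc : ∀ x, F x = (1 - t) • x + t • f x := by
      intro x; simp only [F, v]; rw [smul_sub, sub_smul, one_smul]; abel
    have hmaps : ∀ x ∈ ball (0:E) ρ, F x ∈ ball (0:E) ρ := by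
      intro x hx
      have hx' := h1 x (ball_subset_closedBall hx)
      rw [mem_ball_zero_iff] at hx ⊢
      rw [hFc]
      refine (norm_add_le _ _).trans_lt ?_
      rw [norm_smul, norm_smul, Real.norm_of_nonneg ht.le, Real.norm_of_nonneg (by linarith), hx']
      nlinarith
    have hopen : IsOpen (F '' ball 0 ρ) := by
      rw [isOpen_iff_mem_nhds]
      rintro _ ⟨x, hx, rfl⟩
      have hxc := ball_subset_closedBall hx
      rw [← (hF x (hU hxc)).map_nhds_eq_of_surj]
      · exact image_mem_map (isOpen_ball.mem_nhds hx)
      · have := (hJ x hxc).ne'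
        exact LinearMap.range_eq_top.2 ((LinearMap.equivOfDetNeZero _ this).surjective)
    have himg : F '' ball 0 ρ = ball 0 ρ := by
      apply Subset.antisymm
      · rintro _ ⟨x, hx, rfl⟩; exact hmaps x hx
      · apply (convex_ball (0:E) ρ).isPreconnected.subset_of_closure_inter_subset hopen
        · exact ⟨F 0, hmaps 0 (by simp [hρ]), mem_image_of_mem _ (by simp [hρ])⟩
        · rintro y ⟨hy, hyb⟩
          have hcl : IsClosed (F '' closedBall 0 ρ) := by
            apply IsCompact.isClosed
            apply (isCompact_closedBall (0:E) ρ).image_of_continuousOn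
            exact fun x hx => (hF x (hU hx)).continuousAt.continuousWithinAt
          have := closure_minimal (image_mono ball_subset_closedBall) hcl hy
          obtain ⟨x, hx, rfl⟩ := this
          refine ⟨x, ?_, rfl⟩
          rw [mem_closedBall_zero_iff] at hx
          rw [mem_ball_zero_iff]
          refine lt_of_le_of_ne hx fun h => ?_
          rw [mem_ball_zero_iff, hFc, h2 x h, ← add_smul] at hyb
          simp [h] at hyb
    have cv := integral_image_eq_integral_abs_det_fderiv_smul μ (s := ball (0:E) ρ) (f := F)
      measurableSet_ball (fun x hx => (hF x (hU (ball_subset_closedBall hx))).hasFDerivAt.hasFDerivWithinAt)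
      (hinj.mono ball_subset_closedBall) (fun _ => (1:ℝ))
    rw [himg] at cv
    simp only [smul_eq_mul, mul_one, setIntegral_const] at cv
    rw [cv]
    apply setIntegral_congr_fun measurableSet_ball
    intro x hx
    exact (abs_of_pos (hJ x (ball_subset_closedBall hx))).symm
  have hzero : ∀ x ∈ ball (0:E) ρ, J 1 x = 0 := by
    intro x hx
    have hxc := ball_subset_closedBall hx
    have hfd : HasFDerivAt f (ContinuousLinearMap.id ℝ E + (1:ℝ) • fderiv ℝ v x) x := by
      have := (hasFDerivAt_id x).add (hfD x (hU hxc))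
      rw [one_smul]
      convert this using 1
      ext y; simp [v]
    set A := ContinuousLinearMap.id ℝ E + (1:ℝ) • fderiv ℝ v x
    have hsq : HasFDerivAt (fun y => ‖f y‖ ^ 2) _ x := hfd.norm_sq
    have hconst : HasFDerivAt (fun y => ‖f y‖ ^ 2) (0 : E →L[ℝ] ℝ) x := by
      apply (hasFDerivAt_const (ρ^2) x).congr_of_eventuallyEq
      filter_upwards [isOpen_ball.mem_nhds hx] with y hy
      rw [h1 y (ball_subset_closedBall hy)]
    have heq := hsq.unique hconst
    by_contra hne
    obtain ⟨y, hy⟩ := (LinearMap.equivOfDetNeZero (A : E →ₗ[ℝ] E) hne).surjective (f x)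
    have hy' : A y = f x := hy
    have := congrArg (fun L => L y) heq
    simp [hy', h1 x hxc] at this
    exact hρ.ne' this
  obtain ⟨ts, w, hts, hw, hp⟩ := extrap (Module.finrank ℝ E) δ hδ
  have hJe : ∀ x, J 1 x = ∑ k ∈ Finset.range (Module.finrank ℝ E + 1), w k * J (ts k) x := by
    intro x
    obtain ⟨p, hpd, hpe⟩ := det_poly (fderiv ℝ v x)
    have := hp p hpd
    simpa only [hpe] using this
  have hint : ∀ t, IntegrableOn (J t) (ball 0 ρ) μ := by
    intro t
    have : ContinuousOn (J t) (closedBall 0 ρ) :=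
      ContinuousLinearMap.continuous_det.comp_continuousOn
        (continuousOn_const.add (hcont.const_smul t))
    exact (this.integrableOn_compact (isCompact_closedBall 0 ρ)).mono_set ball_subset_closedBall
  have e1 : ∫ x in ball (0:E) ρ, J 1 x ∂μ = μ.real (ball 0 ρ) := by
    simp_rw [hJe]
    rw [integral_finsetSum _ (fun k _ => (hint _).const_mul _)]
    simp_rw [integral_const_mul]
    rw [Finset.sum_congr rfl (fun k hk => by rw [main (ts k) (hts k hk).1 (hts k hk).2]),
      ← Finset.sum_mul, hw, one_mul]
  have e2 : ∫ x in ball (0:E) ρ, J 1 x ∂μ = 0 := by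
    rw [setIntegral_congr_fun measurableSet_ball hzero]; simp
  have : 0 < μ.real (ball (0:E) ρ) := by
    rw [measureReal_def]
    exact ENNReal.toReal_pos (measure_ball_pos μ 0 hρ).ne' measure_ball_lt_top.ne
  linarith

lemma brouwer (ρ : ℝ) (hρ : 0 < ρ) (G : E → E) (hG : Continuous G) (hb : ∀ x, ‖G x‖ ≤ ρ) :
    ∃ x, G x = x := by
  by_contra! hne
  let R := ρ + 1
  obtain ⟨δ, hδ, hδ1, hδG⟩ : ∃ δ : ℝ, 0 < δ ∧ δ ≤ 1 ∧ ∀ x ∈ closedBall (0:E) R, δ ≤ ‖G x - x‖ := by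
    obtain ⟨x0, -, hx0⟩ := (isCompact_closedBall (0:E) R).exists_isMinOn ⟨0, by simp [R]; positivity⟩
      (f := fun x => ‖G x - x‖) (by fun_prop)
    refine ⟨min 1 ‖G x0 - x0‖, lt_min one_pos (norm_pos_iff.2 (sub_ne_zero.2 (hne x0))),
      min_le_left _ _, fun x hx => (min_le_right _ _).trans (hx0 hx)⟩
  obtain ⟨g, hg, hgG, -⟩ := hG.exists_contDiff_approx (n := 1) (ε := fun _ => δ) continuous_const (fun _ => hδ)
  have hgR : ∀ x, ‖g x‖ < R := by
    intro x
    have := hgG x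
    rw [dist_eq_norm] at this
    have h3 := norm_sub_norm_le (g x) (G x)
    have := hb x
    simp only [R]; linarith
  let V : E → E := fun x => x - g x
  have hV : ContDiff ℝ 1 V := contDiff_id.sub hg
  have hV0 : ∀ x ∈ closedBall (0:E) R, V x ≠ 0 := by
    intro x hx h0
    have h1 := hδG x hx
    have h2 := hgG x
    rw [dist_eq_norm, ← sub_eq_zero.1 h0, norm_sub_rev] at h2
    linarith
  have hip : ∀ x, ‖x‖ = R → 0 < inner ℝ x (V x) := by
    intro x hx
    have h3 := real_inner_le_norm x (g x)
    simp only [V]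
    rw [inner_sub_right, real_inner_self_eq_norm_sq, hx]
    rw [hx] at h3
    have := hgR x
    have : 0 < R := by positivity
    nlinarith
  let Dc : E → ℝ := fun x => (inner ℝ x (V x))^2 + ‖V x‖^2 * (R^2 - ‖x‖^2)
  have hDc : ContDiff ℝ 1 Dc := ((contDiff_id.inner ℝ hV).pow 2).add ((hV.norm_sq ℝ).mul (contDiff_const.sub (contDiff_id.norm_sq ℝ)))
  have hDpos : ∀ x ∈ closedBall (0:E) R, 0 < Dc x := by
    intro x hx
    have hv := norm_pos_iff.2 (hV0 x hx)
    rw [mem_closedBall_zero_iff] at hx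
    rcases hx.eq_or_lt with h | h
    · have := hip x h
      simp only [Dc, h, sub_self, mul_zero, add_zero]
      positivity
    · have : 0 < R^2 - ‖x‖^2 := by nlinarith [norm_nonneg x]
      simp only [Dc]
      positivity
  let s : E → ℝ := fun x => (-(inner ℝ x (V x)) + √(Dc x)) / ‖V x‖^2
  let U : Set E := {x | 0 < Dc x ∧ V x ≠ 0}
  have hUo : IsOpen U := (isOpen_lt continuous_const hDc.continuous).inter
    (isOpen_ne_fun hV.continuous continuous_const)
  have hs : ContDiffOn ℝ 1 s U := by
    apply ContDiffOn.div
    · apply ContDiffOn.add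
      · exact (contDiff_id.inner ℝ hV).neg.contDiffOn
      · exact hDc.contDiffOn.sqrt fun x hx => hx.1.ne'
    · exact (hV.norm_sq ℝ).contDiffOn
    · intro x hx
      exact pow_ne_zero _ (norm_ne_zero_iff.2 hx.2)
  refine no_retract R (by positivity) (fun x => x + s x • V x) U hUo
    (fun x hx => ⟨hDpos x hx, hV0 x hx⟩) (contDiffOn_id.add (hs.smul hV.contDiffOn)) ?_ ?_
  · intro x hx
    have hv := norm_ne_zero_iff.2 (hV0 x hx)
    have hsq := Real.sq_sqrt (hDpos x hx).le
    have : ‖x + s x • V x‖^2 = R^2 := by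
      rw [norm_add_sq_real, inner_smul_right, norm_smul, mul_pow, Real.norm_eq_abs, sq_abs]
      simp only [s]
      field_simp
      simp only [Dc] at hsq ⊢
      linear_combination hsq
    exact (sq_eq_sq₀ (norm_nonneg _) (by positivity)).1 this
  · intro x hx
    have : s x = 0 := by
      simp only [s, Dc, hx, sub_self, mul_zero, add_zero]
      rw [Real.sqrt_sq (hip x hx).le]; simp
    simp [this]

end Brouwer

end Helpers

lemma power_tangent (b r r' Y : ℝ) (hb : 0 < b) (hY0 : 0 ≤ Y) (hY1 : Y < 1)
    (hx : 0 < (2:ℝ) ^ (-(r / b)) - Y) (hx' : 0 < (2:ℝ) ^ (-(r' / b)) - Y) :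
    (1 - Y) * (Real.log 2 / b) * (2:ℝ) ^ (-(r / b)) / ((2:ℝ) ^ (-(r / b)) - Y) ^ 2 * (r' - r) ≤
    (1 - (2:ℝ) ^ (-(r' / b))) / ((2:ℝ) ^ (-(r' / b)) - Y)
      - (1 - (2:ℝ) ^ (-(r / b))) / ((2:ℝ) ^ (-(r / b)) - Y) := by
  have hq : (2:ℝ) ^ (-(r' / b)) * (1 + Real.log 2 / b * (r' - r)) ≤ (2:ℝ) ^ (-(r / b)) := by
    have e : (2:ℝ) ^ (-(r / b)) = (2:ℝ) ^ (-(r' / b)) * Real.exp (Real.log 2 / b * (r' - r)) := by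
      rw [Real.rpow_def_of_pos (by norm_num), Real.rpow_def_of_pos (by norm_num), ← Real.exp_add]
      congr 1
      field_simp
      ring
    rw [e]
    apply mul_le_mul_of_nonneg_left _ (by positivity)
    linarith [Real.add_one_le_exp (Real.log 2 / b * (r' - r))]
  have hp : 0 < (2:ℝ) ^ (-(r / b)) := by positivity
  have hp' : 0 < (2:ℝ) ^ (-(r' / b)) := by positivity
  generalize (2:ℝ) ^ (-(r / b)) = x at *
  generalize (2:ℝ) ^ (-(r' / b)) = x' at *
  have e1 : (1 - x') / (x' - Y) - (1 - x) / (x - Y)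
      = (1 - Y) * ((x - x') * (x - Y)) / ((x - Y) ^ 2 * (x' - Y)) := by
    field_simp
    ring
  have e2 : (1 - Y) * (Real.log 2 / b) * x / (x - Y) ^ 2 * (r' - r)
      = (1 - Y) * (Real.log 2 / b * (r' - r) * x * (x' - Y)) / ((x - Y) ^ 2 * (x' - Y)) := by
    field_simp
  rw [e1, e2]
  generalize Real.log 2 / b * (r' - r) = q at *
  apply div_le_div_of_nonneg_right _ (by positivity)
  apply mul_le_mul_of_nonneg_left _ (by linarith)
  have h1 : x' * (q * x * (x' - Y)) ≤ x' * ((x - x') * (x - Y)) := by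
    have : (x' * q) * (x * (x' - Y)) ≤ (x - x') * (x * (x' - Y)) :=
      mul_le_mul_of_nonneg_right (by linarith) (by positivity)
    nlinarith [mul_nonneg hY0 (sq_nonneg (x - x'))]
  exact le_of_mul_le_mul_left h1 hp'

lemma chain_tangent (A B c S r y : ℝ) (hS : 0 ≤ S) (hy0 : 0 ≤ y) (hr : 1 ≤ r + S) (hy : 1 ≤ y + S)
    (hc : 0 ≤ c) (hcA : c ≤ A) :
    (A * ((r + S) + r) + B + c * S / (r + S) ^ 2) * (y - r) ≤
    y / (y + S) * (A * (y + S) ^ 2 + B * (y + S) + c)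
      - r / (r + S) * (A * (r + S) ^ 2 + B * (r + S) + c) := by
  have h1 : 0 < r + S := by linarith
  have h2 : 0 < y + S := by linarith
  have e : y / (y + S) * (A * (y + S) ^ 2 + B * (y + S) + c)
      - r / (r + S) * (A * (r + S) ^ 2 + B * (r + S) + c)
      - (A * ((r + S) + r) + B + c * S / (r + S) ^ 2) * (y - r)
      = (y - r) ^ 2 * (A - c * (S / (y + S)) * (1 / (r + S) ^ 2)) := by
    field_simp
    ring
  have h3 : S / (y + S) ≤ 1 := by rw [div_le_one h2]; linarith
  have h4 : 1 / (r + S) ^ 2 ≤ 1 := by rw [div_le_one (by positivity)]; nlinarith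
  have h5 : c * (S / (y + S)) * (1 / (r + S) ^ 2) ≤ c := by
    have : c * (S / (y + S)) ≤ c := mul_le_of_le_one_right hc h3
    have h6 : 0 ≤ c * (S / (y + S)) := by positivity
    exact (mul_le_of_le_one_right h6 h4).trans this
  have := mul_nonneg (sq_nonneg (y - r)) (by linarith : 0 ≤ A - c * (S / (y + S)) * (1 / (r + S) ^ 2))
  linarith

/-- Existence of a Nash equilibrium in the noncooperative rate-selection game
of the wireless-powered blockchain crowdsensing system, under the conditions
`a m² ≥ c ≥ 0`, `∑_j ℓ_j ≥ 1`, and `∑_j (1 - 2^{-h_j/b_j}) < 1`. -/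
theorem nash_equilibrium_exists
    {N : Type*} [Fintype N] [DecidableEq N]
    (σ2 m a b0 c φ η : ℝ)
    (hσ2 : 0 < σ2) (hm : 0 < m) (hφ : 0 < φ)
    (lam b g d D α cc ℓ h : N → ℝ)
    (hlam : ∀ i, 0 < lam i) (hb : ∀ i, 0 < b i) (hg : ∀ i, 0 < g i)
    (hd : ∀ i, 0 < d i) (hD : ∀ i, 0 < D i)
    (hℓ : ∀ i, 0 ≤ ℓ i) (hℓh : ∀ i, ℓ i ≤ h i)
    (hac : c ≤ a * m ^ 2) (hc : 0 ≤ c)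
    (hsum : 1 ≤ ∑ j, ℓ j)
    (hX : (∑ j, (1 - (2 : ℝ) ^ (-(h j / b j)))) < 1)
    (u : N → (N → ℝ) → ℝ)
    (hu : ∀ i r, u i r
        = lam i * r i
          - φ * D i ^ η *
              (cc i + (d i ^ α i / g i) * σ2 * (1 - (2 : ℝ) ^ (-(r i / b i)))
                / ((2 : ℝ) ^ (-(r i / b i))
                    - ∑ j ∈ Finset.univ.erase i, (1 - (2 : ℝ) ^ (-(r j / b j)))))
          - (r i / ∑ j, r j) *
              (a * (m * ∑ j, r j) ^ 2 + b0 * (m * ∑ j, r j) + c)) :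
    ∃ rstar : N → ℝ,
      (∀ i, rstar i ∈ Set.Icc (ℓ i) (h i)) ∧
        ∀ i, ∀ ri ∈ Set.Icc (ℓ i) (h i),
          u i (Function.update rstar i ri) ≤ u i rstar := by
  let x : N → ℝ → ℝ := fun i t => (2:ℝ) ^ (-(t / b i))
  let Y : N → (N → ℝ) → ℝ := fun i r => ∑ j ∈ Finset.univ.erase i, (1 - x j (r j))
  let S : N → (N → ℝ) → ℝ := fun i r => ∑ j ∈ Finset.univ.erase i, r j
  let K : N → ℝ := fun i => φ * D i ^ η * (d i ^ α i / g i * σ2)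
  have hK : ∀ i, 0 ≤ K i := fun i => by
    have := Real.rpow_pos_of_pos (hD i) η
    have := Real.rpow_pos_of_pos (hd i) (α i)
    have := hg i
    positivity
  let F : N → (N → ℝ) → ℝ := fun i r =>
    lam i - K i * ((1 - Y i r) * (Real.log 2 / b i) * x i (r i) / (x i (r i) - Y i r) ^ 2)
      - (a * m ^ 2 * ((r i + S i r) + r i) + b0 * m + c * S i r / (r i + S i r) ^ 2)
  let Bx : Set (N → ℝ) := {r | ∀ i, r i ∈ Set.Icc (ℓ i) (h i)}
  have hx1 : ∀ r ∈ Bx, ∀ j, x j (r j) ≤ 1 := by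
    intro r hr j
    apply Real.rpow_le_one_of_one_le_of_nonpos (by norm_num)
    have := div_nonneg ((hℓ j).trans (hr j).1) (hb j).le
    linarith
  have hY0 : ∀ r ∈ Bx, ∀ i, 0 ≤ Y i r := fun r hr i =>
    Finset.sum_nonneg fun j _ => by linarith [hx1 r hr j]
  have hxY : ∀ r ∈ Bx, ∀ i, 0 < x i (r i) - Y i r := by
    intro r hr i
    have h1 : ∑ j, (1 - x j (r j)) ≤ ∑ j, (1 - (2 : ℝ) ^ (-(h j / b j))) := by
      apply Finset.sum_le_sum
      intro j _
      apply sub_le_sub_left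
      apply Real.rpow_le_rpow_of_exponent_le (by norm_num)
      exact neg_le_neg (div_le_div_of_nonneg_right (hr j).2 (hb j).le)
    rw [← Finset.add_sum_erase _ _ (Finset.mem_univ i)] at h1
    change (1 - x i (r i)) + Y i r ≤ _ at h1
    linarith
  have hS0 : ∀ r ∈ Bx, ∀ i, 0 ≤ S i r := fun r hr i =>
    Finset.sum_nonneg fun j _ => (hℓ j).trans (hr j).1
  have hrS : ∀ r i, r i + S i r = ∑ j, r j := fun r i =>
    Finset.add_sum_erase _ _ (Finset.mem_univ i)
  have hS1 : ∀ r ∈ Bx, ∀ i, 1 ≤ r i + S i r := by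
    intro r hr i
    rw [hrS]
    exact hsum.trans (Finset.sum_le_sum fun j _ => (hr j).1)
  -- utility in the new notation
  have hu' : ∀ i r, u i r = lam i * r i - φ * D i ^ η * cc i
      - K i * ((1 - x i (r i)) / (x i (r i) - Y i r))
      - r i / (r i + S i r) *
        (a * m ^ 2 * (r i + S i r) ^ 2 + b0 * m * (r i + S i r) + c) := by
    intro i r
    rw [hu, hrS]
    simp only [K, x, Y]
    ring
  have hupY : ∀ i r t, Y i (Function.update r i t) = Y i r := by
    intro i r t
    refine Finset.sum_congr rfl fun j hj => ?_
    rw [Function.update_of_ne (Finset.ne_of_mem_erase hj)]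
  have hupS : ∀ i r t, S i (Function.update r i t) = S i r := by
    intro i r t
    refine Finset.sum_congr rfl fun j hj => ?_
    rw [Function.update_of_ne (Finset.ne_of_mem_erase hj)]
  have htan : ∀ r ∈ Bx, ∀ i, ∀ t ∈ Set.Icc (ℓ i) (h i),
      u i (Function.update r i t) ≤ u i r + F i r * (t - r i) := by
    intro r hr i t ht
    have hr' : Function.update r i t ∈ Bx := by
      intro j
      by_cases hj : j = i
      · subst hj; simpa using ht
      · rw [Function.update_of_ne hj]; exact hr j
    have p1 := hxY _ hr' i
    have p2 := hS1 _ hr' i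
    rw [hupY, Function.update_self] at p1
    rw [hupS, Function.update_self] at p2
    have T1 := power_tangent (b i) (r i) t (Y i r) (hb i) (hY0 r hr i)
      (by linarith [hx1 r hr i, hxY r hr i]) (hxY r hr i) p1
    have T2 := chain_tangent (a * m ^ 2) (b0 * m) c (S i r) (r i) t (hS0 r hr i)
      ((hℓ i).trans ht.1) (hS1 r hr i) p2 hc hac
    have T3 := mul_le_mul_of_nonneg_left T1 (hK i)
    rw [hu', hu', hupY, hupS, Function.update_self]
    simp only [F, x] at *
    linarith
  let cl : N → ℝ → ℝ := fun i t => max (ℓ i) (min (h i) t)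
  have hcl : ∀ i t, cl i t ∈ Set.Icc (ℓ i) (h i) := fun i t =>
    ⟨le_max_left _ _, max_le (hℓh i) (min_le_left _ _)⟩
  have hclid : ∀ i, ∀ t ∈ Set.Icc (ℓ i) (h i), cl i t = t := fun i t ht => by
    simp only [cl]; rw [min_eq_right ht.2, max_eq_right ht.1]
  let P : EuclideanSpace ℝ N → N → ℝ := fun z i => cl i (z i)
  have hP : ∀ z, P z ∈ Bx := fun z i => hcl i _
  have hPc : ∀ i, Continuous fun z => P z i := fun i => by
    simp only [P, cl]; fun_prop
  have hxc : ∀ i, Continuous fun z => x i (P z i) := fun i => by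
    simp only [x]
    exact Continuous.rpow continuous_const ((hPc i).div_const _).neg (fun _ => Or.inl (by norm_num))
  have hYc : ∀ i, Continuous fun z => Y i (P z) := fun i =>
    continuous_finsetSum _ fun j _ => continuous_const.sub (hxc j)
  have hSc : ∀ i, Continuous fun z => S i (P z) := fun i =>
    continuous_finsetSum _ fun j _ => hPc j
  have hFc : ∀ i, Continuous fun z => F i (P z) := by
    intro i
    have := hPc i
    have := hxc i
    have := hYc i
    have := hSc i
    have n1 : ∀ z, (x i (P z i) - Y i (P z)) ^ 2 ≠ 0 := fun z => pow_ne_zero _ (hxY _ (hP z) i).ne'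
    have n2 : ∀ z, (P z i + S i (P z)) ^ 2 ≠ 0 := fun z =>
      pow_ne_zero _ (by linarith [hS1 _ (hP z) i])
    have c1 : Continuous fun z => (1 - Y i (P z)) * (Real.log 2 / b i) * x i (P z i) /
      (x i (P z i) - Y i (P z)) ^ 2 :=
      Continuous.div (((continuous_const.sub (hYc i)).mul continuous_const).mul (hxc i))
        (((hxc i).sub (hYc i)).pow 2) n1
    have c2 : Continuous fun z => c * S i (P z) / (P z i + S i (P z)) ^ 2 :=
      Continuous.div (by fun_prop) (by fun_prop) n2
    simp only [F]
    fun_prop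
  let G : EuclideanSpace ℝ N → EuclideanSpace ℝ N := fun z =>
    WithLp.toLp 2 fun i => cl i (z i + F i (P z))
  have hGc : Continuous G := by
    apply (PiLp.continuous_toLp 2 _).comp
    apply continuous_pi
    intro i
    have hzc : Continuous fun z : EuclideanSpace ℝ N => z i := by fun_prop
    exact continuous_const.max (continuous_const.min (hzc.add (hFc i)))
  obtain ⟨z, hz⟩ := brouwer (√(∑ i, h i ^ 2) + 1) (by positivity) G hGc (by
    intro z
    rw [EuclideanSpace.norm_eq]
    refine (Real.sqrt_le_sqrt (Finset.sum_le_sum fun i _ => ?_)).trans (by linarith)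
    have h1 := hcl i (z i + F i (P z))
    change ‖cl i (z i + F i (P z))‖ ^ 2 ≤ _
    have h0 := (hℓ i).trans h1.1
    rw [Real.norm_of_nonneg h0]
    exact pow_le_pow_left₀ h0 h1.2 2)
  have hzi : ∀ i, cl i (z i + F i (P z)) = z i := fun i => congrArg (fun w => w i) hz
  have hPz : ∀ i, P z i = z i := fun i => hclid i _ (by rw [← hzi i]; exact hcl i _)
  refine ⟨P z, hP z, fun i t ht => (htan (P z) (hP z) i t ht).trans ?_⟩
  have e := hzi i
  rw [← hPz i] at e
  have hle : F i (P z) * (t - P z i) ≤ 0 := by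
    have hb1 := hP z i
    generalize F i (P z) = f at *
    generalize P z i = p at *
    simp only [cl] at e
    rcases le_total 0 f with hf | hf
    · rcases le_total (h i) (p + f) with h1 | h1
      · rw [min_eq_left h1, max_eq_right (hℓh i)] at e
        exact mul_nonpos_of_nonneg_of_nonpos hf (by linarith [ht.2])
      · rw [min_eq_right h1, max_eq_right (by linarith [hb1.1])] at e
        have : f = 0 := by linarith
        simp [this]
    · rw [min_eq_right (by linarith [hb1.2])] at e
      rcases le_total (ℓ i) (p + f) with h1 | h1
      · rw [max_eq_right h1] at e
        have : f = 0 := by linarith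
        simp [this]
      · rw [max_eq_left h1] at e
        exact mul_nonpos_of_nonpos_of_nonneg hf (by linarith [ht.1])
  linarith
end
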